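/- arXiv:2105.10229 — 3 statements merged into one kernel-verified Lean document; each statement's English description precedes it below -/
import Mathlib

section
/- For every k ∈ ℕ and all vertices i, j, we have j ∈ X k i if and only if there is a directed walk from j to i of length at most k (equivalently, j reaches i and dist(j,i) ≤ k). -/
open scoped Classical

variable {V : Type*}

/-- Walks of length exactly `n`: `stepRel Adj n u v` means there is a directed walk
from `u` to `v` of length `n`. -/
def stepRel (Adj : V → V → Prop) : ℕ → V → V → Prop
  | 0 => Eq
  | (n+1) => fun u v => ∃ w, Adj u w ∧ stepRel Adj n w v

/-- `ddist Adj u v` is the minimum length of a directed walk from `u` to `v`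
(meaningful when `u` reaches `v`). -/
noncomputable def ddist (Adj : V → V → Prop) (u v : V) : ℕ :=
  sInf {n | stepRel Adj n u v}

/-- `reachSet Adj v` is the finite set of vertices that reach `v`. -/
noncomputable def reachSet [Fintype V] (Adj : V → V → Prop) (v : V) : Finset V :=
  Finset.univ.filter (fun u => Relation.ReflTransGen Adj u v)

/-- In-eccentricity: the maximum of `ddist Adj j i` over all `j` reaching `i`. -/
noncomputable def ecc [Fintype V] (Adj : V → V → Prop) (i : V) : ℕ :=
  (Finset.univ.filter (fun j => Relation.ReflTransGen Adj j i)).sup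
    (fun j => ddist Adj j i)

/-- Finite digraph diameter: maximum of `ddist Adj u v` over ordered pairs `(u, v)`
with `u` reaching `v`. -/
noncomputable def fdiam [Fintype V] (Adj : V → V → Prop) : ℕ :=
  (Finset.univ.filter (fun p : V × V => Relation.ReflTransGen Adj p.1 p.2)).sup
    (fun p => ddist Adj p.1 p.2)

/-- Algorithm 1's flooding iteration: `flood Adj 0 i = {i}` and
`flood Adj (k+1) i = flood Adj k i ∪ ⋃_{j with Adj j i} flood Adj k j`. -/
noncomputable def flood [Fintype V] [DecidableEq V] (Adj : V → V → Prop) : ℕ → V → Finset V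
  | 0, i => {i}
  | (k+1), i => flood Adj k i ∪
      (Finset.univ.filter (fun j => Adj j i)).biUnion (fun j => flood Adj k j)

theorem stepRel_succ_iff (Adj : V → V → Prop) (n : ℕ) (u v : V) :
    stepRel Adj (n + 1) u v ↔ ∃ w, stepRel Adj n u w ∧ Adj w v := by
  induction n generalizing u with
  | zero => simp [stepRel]
  | succ n ih =>
    rw [stepRel]
    simp only [ih]
    constructor
    · rintro ⟨w, hw, x, hx, hxv⟩
      exact ⟨x, ⟨w, hw, hx⟩, hxv⟩
    · rintro ⟨x, ⟨w, hw, hx⟩, hxv⟩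
      exact ⟨w, hw, x, hx, hxv⟩

theorem reflTransGen_iff_exists_stepRel (Adj : V → V → Prop) (u v : V) :
    Relation.ReflTransGen Adj u v ↔ ∃ n, stepRel Adj n u v := by
  constructor
  · intro h
    induction h with
    | refl => exact ⟨0, rfl⟩
    | tail _ hbc ih =>
      obtain ⟨n, hn⟩ := ih
      exact ⟨n + 1, (stepRel_succ_iff Adj n u _).2 ⟨_, hn, hbc⟩⟩
  · rintro ⟨n, hn⟩
    induction n generalizing u with
    | zero =>
      obtain rfl : u = v := hn
      exact .refl
    | succ n ih =>
      obtain ⟨w, hw, hwv⟩ := hn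
      exact .head hw (ih w hwv)

theorem exists_le_stepRel_iff (Adj : V → V → Prop) (k : ℕ) (u v : V) :
    (∃ n ≤ k, stepRel Adj n u v) ↔ Relation.ReflTransGen Adj u v ∧ ddist Adj u v ≤ k := by
  rw [reflTransGen_iff_exists_stepRel]
  constructor
  · rintro ⟨n, hn, h⟩
    exact ⟨⟨n, h⟩, (Nat.sInf_le h).trans hn⟩
  · rintro ⟨hne, hd⟩
    exact ⟨ddist Adj u v, hd, Nat.sInf_mem (s := {n | stepRel Adj n u v}) hne⟩

theorem mem_flood_iff [Fintype V] [DecidableEq V] (Adj : V → V → Prop) (k : ℕ) (i j : V) :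
    j ∈ flood Adj k i ↔ ∃ n ≤ k, stepRel Adj n j i := by
  induction k generalizing i with
  | zero => simp [flood, stepRel]
  | succ k ih =>
    simp only [flood, Finset.mem_union, Finset.mem_biUnion, Finset.mem_filter,
      Finset.mem_univ, true_and, ih]
    constructor
    · rintro (⟨n, hn, h⟩ | ⟨w, hw, n, hn, h⟩)
      · exact ⟨n, by omega, h⟩
      · exact ⟨n + 1, by omega, (stepRel_succ_iff Adj n j i).2 ⟨w, h, hw⟩⟩
    · rintro ⟨n, hn, h⟩
      cases n with
      | zero => exact .inl ⟨0, by omega, h⟩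
      | succ n =>
        obtain ⟨w, h, hw⟩ := (stepRel_succ_iff Adj n j i).1 h
        exact .inr ⟨w, hw, n, by omega, h⟩

/-- `j ∈ X k i` iff there is a directed walk from `j` to `i` of length
at most `k` (equivalently, `j` reaches `i` and `dist(j,i) ≤ k`). -/
theorem stmt0 [Fintype V] [DecidableEq V] (Adj : V → V → Prop) (k : ℕ) (i j : V) :
    (j ∈ flood Adj k i ↔ ∃ n ≤ k, stepRel Adj n j i) ∧
    (j ∈ flood Adj k i ↔ Relation.ReflTransGen Adj j i ∧ ddist Adj j i ≤ k) := by
  exact ⟨mem_flood_iff Adj k i j,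
    (mem_flood_iff Adj k i j).trans (exists_le_stepRel_iff Adj k j i)⟩
end

section
/- Soundness of the local stopping criterion: if for some k ∈ ℕ and some vertex i one has X (k+1) i = X k i, then X m i = X k i for all m ≥ k, and moreover X k i = reach(i), the set of all vertices that reach i. -/
open scoped Classical

variable {V : Type*}

theorem flood_mono [Fintype V] [DecidableEq V] (Adj : V → V → Prop) (i : V) :
    Monotone fun k => flood Adj k i :=
  monotone_nat_of_le_succ fun _ => Finset.subset_union_left

theorem mem_flood_succ [Fintype V] [DecidableEq V] {Adj : V → V → Prop} {k : ℕ} {u i : V} :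
    u ∈ flood Adj (k + 1) i ↔ u ∈ flood Adj k i ∨ ∃ j, Adj j i ∧ u ∈ flood Adj k j := by
  simp [flood]

theorem self_mem_flood [Fintype V] [DecidableEq V] (Adj : V → V → Prop) (k : ℕ) (i : V) :
    i ∈ flood Adj k i :=
  flood_mono Adj i (Nat.zero_le k) (by simp [flood])

theorem mem_flood_succ_of_adj [Fintype V] [DecidableEq V] {Adj : V → V → Prop} {u w : V}
    (huw : Adj u w) {k : ℕ} {i : V} (hw : w ∈ flood Adj k i) : u ∈ flood Adj (k + 1) i := by
  induction k generalizing i with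
  | zero =>
    obtain rfl : w = i := by simpa [flood] using hw
    exact mem_flood_succ.2 (.inr ⟨u, huw, self_mem_flood Adj 0 u⟩)
  | succ k ih =>
    obtain hw | ⟨j, hj, hw⟩ := mem_flood_succ.1 hw
    · exact mem_flood_succ.2 (.inl (ih hw))
    · exact mem_flood_succ.2 (.inr ⟨j, hj, ih hw⟩)

theorem flood_subset_reachSet [Fintype V] [DecidableEq V] (Adj : V → V → Prop) (k : ℕ) (i : V) :
    flood Adj k i ⊆ reachSet Adj i := by
  intro u hu
  simp only [reachSet, Finset.mem_filter, Finset.mem_univ, true_and]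
  induction k generalizing i with
  | zero =>
    obtain rfl : u = i := by simpa [flood] using hu
    exact .refl
  | succ k ih =>
    obtain hu | ⟨j, hj, hu⟩ := mem_flood_succ.1 hu
    · exact ih i hu
    · exact (ih j hu).tail hj

theorem reachSet_subset_flood [Fintype V] [DecidableEq V] {Adj : V → V → Prop} {k : ℕ} {i : V}
    (h : flood Adj (k + 1) i = flood Adj k i) : reachSet Adj i ⊆ flood Adj k i := by
  intro u hu
  simp only [reachSet, Finset.mem_filter, Finset.mem_univ, true_and] at hu
  induction hu using Relation.ReflTransGen.head_induction_on with
  | refl => exact self_mem_flood Adj k i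
  | head huw _ ih => exact h ▸ mem_flood_succ_of_adj huw ih

/-- soundness of the local stopping criterion: if `X (k+1) i = X k i`
then `X m i = X k i` for all `m ≥ k`, and `X k i = reach(i)`. -/
theorem stmt4 [Fintype V] [DecidableEq V] (Adj : V → V → Prop) (k : ℕ) (i : V)
    (h : flood Adj (k+1) i = flood Adj k i) :
    (∀ m ≥ k, flood Adj m i = flood Adj k i) ∧
    flood Adj k i = reachSet Adj i := by
  have hsub := reachSet_subset_flood h
  exact ⟨fun m hm => ((flood_subset_reachSet Adj m i).trans hsub).antisymm (flood_mono Adj i hm),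
    (flood_subset_reachSet Adj k i).antisymm hsub⟩
end

section
/- Characterization of strongly connected components (core of Theorem 1): for every vertex i, the set S_i := {j : j reaches i and |reach(j)| = |reach(i)|} equals the strongly connected component of i, i.e. S_i = {j : j reaches i and i reaches j}. -/
open scoped Classical

variable {V : Type*}

theorem mem_reachSet [Fintype V] {Adj : V → V → Prop} {u v : V} :
    u ∈ reachSet Adj v ↔ Relation.ReflTransGen Adj u v := by
  simp [reachSet]

theorem reachSet_subset_reachSet [Fintype V] {Adj : V → V → Prop} {u v : V}
    (h : Relation.ReflTransGen Adj u v) : reachSet Adj u ⊆ reachSet Adj v :=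
  fun _ hw => mem_reachSet.2 ((mem_reachSet.1 hw).trans h)

/-- core of Theorem 1: for every vertex `i`,
`{j : j reaches i ∧ |reach(j)| = |reach(i)|}` equals the SCC of `i`. -/
theorem stmt10 [Fintype V] (Adj : V → V → Prop) (i : V) :
    {j : V | Relation.ReflTransGen Adj j i ∧
        (reachSet Adj j).card = (reachSet Adj i).card} =
    {j : V | Relation.ReflTransGen Adj j i ∧ Relation.ReflTransGen Adj i j} := by
  ext j
  refine and_congr_right fun hji => ⟨fun hcard => ?_, fun hij => ?_⟩
  · rw [← mem_reachSet, Finset.eq_of_subset_of_card_le (reachSet_subset_reachSet hji) hcard.ge]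
    exact mem_reachSet.2 .refl
  · rw [(reachSet_subset_reachSet hji).antisymm (reachSet_subset_reachSet hij)]
end
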